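/- Let R be a ring and S, T left denominator sets in R. If the multiplicative submonoid ST of (R,·) generated by S and T does not contain 0, then ST is a left denominator set in R. -/

import Mathlib

/-- A left Ore set in a ring `R`: a multiplicative subset (`1 ∈ S`, `0 ∉ S`,
closed under multiplication) satisfying the left Ore condition. -/
def IsLeftOreSet (R : Type*) [Ring R] (S : Set R) : Prop :=
  (1 : R) ∈ S ∧ (0 : R) ∉ S ∧ (∀ s ∈ S, ∀ t ∈ S, s * t ∈ S) ∧
    ∀ (r : R), ∀ s ∈ S, ∃ s' ∈ S, ∃ r' : R, s' * r = r' * s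

/-- A left denominator set: a left Ore set such that `r * s = 0` implies
`t * r = 0` for some `t ∈ S`. -/
def IsLeftDenSet (R : Type*) [Ring R] (S : Set R) : Prop :=
  IsLeftOreSet R S ∧ ∀ (r : R), ∀ s ∈ S, r * s = 0 → ∃ t ∈ S, t * r = 0

/-- `ass(S) = {r ∈ R | s r = 0 for some s ∈ S}`. -/
def assSet (R : Type*) [Ring R] (S : Set R) : Set R :=
  {r : R | ∃ s ∈ S, s * r = 0}

/-- A maximal left denominator set of `R`. -/
def IsMaxLeftDenSet (R : Type*) [Ring R] (S : Set R) : Prop :=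
  IsLeftDenSet R S ∧ ∀ T : Set R, IsLeftDenSet R T → S ⊆ T → T = S

/-- The set `L^s_l(R)` of strongly left localizable elements: the intersection of
all maximal left denominator sets of `R`. -/
def stronglyLocalizable (R : Type*) [Ring R] : Set R :=
  {r : R | ∀ S : Set R, IsMaxLeftDenSet R S → r ∈ S}

/-- `T_l(R)`: the union of all left denominator sets contained in `L^s_l(R)`
(the largest strong left denominator set). -/
def Tl (R : Type*) [Ring R] : Set R :=
  ⋃₀ {S : Set R | IsLeftDenSet R S ∧ S ⊆ stronglyLocalizable R}

/-- The left localization radical `l_R = ⋂_{S ∈ max.Den_l(R)} ass(S)`. -/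
def lRad (R : Type*) [Ring R] : Set R :=
  {r : R | ∀ S : Set R, IsMaxLeftDenSet R S → r ∈ assSet R S}

/-- `f : R →+* Q` is a left Ore localization of `R` at `S`: elements of `S` become
units, every element of `Q` is of the form `s⁻¹ r`, and `ker f = ass(S)`. -/
def IsLeftLocalization (R : Type*) [Ring R] {Q : Type*} [Ring Q]
    (S : Set R) (f : R →+* Q) : Prop :=
  (∀ s ∈ S, IsUnit (f s)) ∧
  (∀ q : Q, ∃ s ∈ S, ∃ r : R, ∃ u : Qˣ, (u : Q) = f s ∧ q = (↑u⁻¹ : Q) * f r) ∧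
  (∀ r : R, f r = 0 ↔ r ∈ assSet R S)

theorem stmt1 (R : Type*) [Ring R] (S T : Set R)
    (hS : IsLeftDenSet R S) (hT : IsLeftDenSet R T)
    (h0 : (0 : R) ∉ (Submonoid.closure (S ∪ T) : Set R)) :
    IsLeftDenSet R (Submonoid.closure (S ∪ T) : Set R) := by
  obtain ⟨⟨-, -, -, hSo⟩, hSd⟩ := hS
  obtain ⟨⟨-, -, -, hTo⟩, hTd⟩ := hT
  refine ⟨⟨one_mem _, h0, fun s hs t ht => mul_mem hs ht, ?_⟩, ?_⟩
  · intro r s hs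
    induction hs using Submonoid.closure_induction generalizing r with
    | mem x hx =>
      rcases hx with hx | hx
      · obtain ⟨s', hs', r', h⟩ := hSo r x hx
        exact ⟨s', Submonoid.subset_closure (Or.inl hs'), r', h⟩
      · obtain ⟨s', hs', r', h⟩ := hTo r x hx
        exact ⟨s', Submonoid.subset_closure (Or.inr hs'), r', h⟩
    | one => exact ⟨1, one_mem _, r, by simp⟩
    | mul x y _ _ ihx ihy =>
      obtain ⟨s1, hs1, r1, h1⟩ := ihy r
      obtain ⟨s2, hs2, r2, h2⟩ := ihx r1
      exact ⟨s2 * s1, mul_mem hs2 hs1, r2, by rw [mul_assoc, h1, ← mul_assoc, h2, mul_assoc]⟩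
  · intro r s hs
    induction hs using Submonoid.closure_induction generalizing r with
    | mem x hx =>
      intro h
      rcases hx with hx | hx
      · obtain ⟨t, ht, h⟩ := hSd r x hx h
        exact ⟨t, Submonoid.subset_closure (Or.inl ht), h⟩
      · obtain ⟨t, ht, h⟩ := hTd r x hx h
        exact ⟨t, Submonoid.subset_closure (Or.inr ht), h⟩
    | one => exact fun h => ⟨1, one_mem _, by simpa using h⟩
    | mul x y _ _ ihx ihy =>
      intro h
      obtain ⟨t1, ht1, h1⟩ := ihy (r * x) (by rw [mul_assoc, h])
      obtain ⟨t2, ht2, h2⟩ := ihx (t1 * r) (by rw [mul_assoc, h1])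
      exact ⟨t2 * t1, mul_mem ht2 ht1, by rw [mul_assoc, h2]⟩
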